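/- Let L and m be nonnegative integers and let q be a complex number with q ≠ 0 and q^i ≠ 1 for every integer i ≥ 1. Then Σ_{k=0}^{m} q^k · (q^{2(⌊(L+m)/2⌋−m+1)};q²)_{m−k} · (q^{2(⌊(L+m−1)/2⌋−m+1)};q²)_k / (q²;q²)_m · [m choose k]_{q²} = [L choose m]_q, where ⌊·⌋ is the floor function. -/

import Mathlib

open scoped BigOperators

/-- The finite q-Pochhammer symbol `(a;q)_n = ∏_{i=0}^{n-1} (1 - a q^i)`. -/
noncomputable def qPoch (a q : ℂ) (n : ℕ) : ℂ := ∏ i ∈ Finset.range n, (1 - a * q ^ i)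

/-- The Gaussian (q-binomial) coefficient `[n choose k]_q`, equal to
`(q;q)_n / ((q;q)_{n-k} (q;q)_k)` when `0 ≤ k ≤ n` and `0` otherwise. -/
noncomputable def qBinom (q : ℂ) (n k : ℤ) : ℂ :=
  if 0 ≤ k ∧ k ≤ n then
    qPoch q q n.toNat / (qPoch q q (n - k).toNat * qPoch q q k.toNat)
  else 0

/-- The power series `∑ (a;p)_n / (p;p)_n X^n` of the `q`-binomial theorem. -/
noncomputable def qBinomSeries (a p : ℂ) : PowerSeries ℂ :=
  PowerSeries.mk fun n => qPoch a p n / qPoch p p n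

lemma qPoch_zero (a q : ℂ) : qPoch a q 0 = 1 := by simp [qPoch]

lemma qPoch_succ (a q : ℂ) (n : ℕ) : qPoch a q (n + 1) = qPoch a q n * (1 - a * q ^ n) := by
  simp [qPoch, Finset.prod_range_succ]

lemma qPoch_succ' (a q : ℂ) (n : ℕ) : qPoch a q (n + 1) = (1 - a) * qPoch (a * q) q n := by
  simp only [qPoch, Finset.prod_range_succ', pow_zero, mul_one]
  rw [mul_comm]
  congr 1
  exact Finset.prod_congr rfl fun i _ => by ring

lemma qPoch_self_ne_zero {q : ℂ} (hq : ∀ i : ℕ, 1 ≤ i → q ^ i ≠ 1) (n : ℕ) :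
    qPoch q q n ≠ 0 := by
  refine Finset.prod_ne_zero_iff.mpr fun i _ => sub_ne_zero.mpr ?_
  rw [← pow_succ']
  exact (hq (i + 1) (by omega)).symm

lemma qPoch_self_mul_qPoch (q : ℂ) (n m : ℕ) :
    qPoch q q n * qPoch (q ^ (n + 1)) q m = qPoch q q (n + m) := by
  rw [qPoch, qPoch, qPoch, Finset.prod_range_add]
  congr 1
  exact Finset.prod_congr rfl fun i _ => by ring

lemma coeff_succ_one_sub_C_mul_X_mul (c : ℂ) (G : PowerSeries ℂ) (n : ℕ) :
    PowerSeries.coeff (n + 1) ((1 - PowerSeries.C c * PowerSeries.X) * G) =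
      PowerSeries.coeff (n + 1) G - c * PowerSeries.coeff n G := by
  rw [sub_mul, one_mul, map_sub, mul_assoc, PowerSeries.coeff_C_mul, PowerSeries.coeff_succ_X_mul]

lemma coeff_zero_one_sub_C_mul_X_mul (c : ℂ) (G : PowerSeries ℂ) :
    PowerSeries.coeff 0 ((1 - PowerSeries.C c * PowerSeries.X) * G) = PowerSeries.coeff 0 G := by
  simp

lemma coeff_qBinomSeries (a p : ℂ) (n : ℕ) :
    PowerSeries.coeff n (qBinomSeries a p) = qPoch a p n / qPoch p p n :=
  PowerSeries.coeff_mk _ _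

lemma one_sub_pow_succ_ne_zero {p : ℂ} (hp : ∀ i : ℕ, 1 ≤ i → p ^ i ≠ 1) (n : ℕ) :
    1 - p * p ^ n ≠ 0 := by
  rw [← pow_succ', sub_ne_zero]
  exact (hp (n + 1) (by omega)).symm

/-- The first-order `q`-difference equation determines the coefficients. -/
lemma coeff_of_one_sub_X_mul_eq {a q : ℂ} (hq : ∀ i : ℕ, 1 ≤ i → q ^ i ≠ 1)
    {G : PowerSeries ℂ} (h0 : PowerSeries.coeff 0 G = 1)
    (h : (1 - PowerSeries.C 1 * PowerSeries.X) * G =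
      (1 - PowerSeries.C a * PowerSeries.X) * PowerSeries.rescale q G) (n : ℕ) :
    PowerSeries.coeff n G = qPoch a q n / qPoch q q n := by
  induction n with
  | zero => simpa [qPoch] using h0
  | succ n ih =>
    have hn := congrArg (PowerSeries.coeff (n + 1)) h
    rw [coeff_succ_one_sub_C_mul_X_mul, coeff_succ_one_sub_C_mul_X_mul, PowerSeries.coeff_rescale,
      PowerSeries.coeff_rescale] at hn
    have h1 := one_sub_pow_succ_ne_zero hq n
    have h2 := qPoch_self_ne_zero hq n
    have h3 : PowerSeries.coeff (n + 1) G * (1 - q * q ^ n) =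
        (1 - a * q ^ n) * PowerSeries.coeff n G := by linear_combination hn
    rw [qPoch_succ, qPoch_succ, eq_div_iff (mul_ne_zero h2 h1), mul_left_comm, h3, ih]
    field_simp

lemma one_sub_X_mul_qBinomSeries_mul {p : ℂ} (hp : ∀ i : ℕ, 1 ≤ i → p ^ i ≠ 1) (b : ℂ) :
    (1 - PowerSeries.C 1 * PowerSeries.X) * qBinomSeries (b * p) p =
      PowerSeries.rescale p (qBinomSeries b p) := by
  ext n
  cases n with
  | zero =>
    rw [coeff_zero_one_sub_C_mul_X_mul, PowerSeries.coeff_rescale]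
    simp [coeff_qBinomSeries, qPoch_zero]
  | succ n =>
    have h1 := one_sub_pow_succ_ne_zero hp n
    have h2 := qPoch_self_ne_zero hp n
    rw [coeff_succ_one_sub_C_mul_X_mul, PowerSeries.coeff_rescale, coeff_qBinomSeries,
      coeff_qBinomSeries, coeff_qBinomSeries, qPoch_succ' b, qPoch_succ, qPoch_succ]
    field_simp
    ring

lemma one_sub_C_mul_X_mul_qBinomSeries_mul {p : ℂ} (hp : ∀ i : ℕ, 1 ≤ i → p ^ i ≠ 1) (b : ℂ) :
    (1 - PowerSeries.C b * PowerSeries.X) * qBinomSeries (b * p) p = qBinomSeries b p := by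
  ext n
  cases n with
  | zero =>
    rw [coeff_zero_one_sub_C_mul_X_mul]
    simp [coeff_qBinomSeries, qPoch_zero]
  | succ n =>
    have h1 := one_sub_pow_succ_ne_zero hp n
    have h2 := qPoch_self_ne_zero hp n
    rw [coeff_succ_one_sub_C_mul_X_mul, coeff_qBinomSeries,
      coeff_qBinomSeries, coeff_qBinomSeries, qPoch_succ' b, qPoch_succ, qPoch_succ]
    field_simp
    ring

lemma one_sub_X_mul_qBinomSeries {p : ℂ} (hp : ∀ i : ℕ, 1 ≤ i → p ^ i ≠ 1) (a : ℂ) :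
    (1 - PowerSeries.C 1 * PowerSeries.X) * qBinomSeries a p =
      (1 - PowerSeries.C a * PowerSeries.X) * PowerSeries.rescale p (qBinomSeries a p) := by
  rw [← one_sub_X_mul_qBinomSeries_mul hp a, mul_left_comm,
    one_sub_C_mul_X_mul_qBinomSeries_mul hp]

lemma coeff_zero_qBinomSeries_mul_rescale (a b p q : ℂ) :
    PowerSeries.coeff 0 (qBinomSeries a p * PowerSeries.rescale q (qBinomSeries b p)) = 1 := by
  rw [PowerSeries.coeff_mul, Finset.Nat.antidiagonal_zero, Finset.sum_singleton,
    PowerSeries.coeff_rescale]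
  simp [coeff_qBinomSeries, qPoch_zero]

lemma coeff_qBinomSeries_mul_rescale_self {q : ℂ} (hq : ∀ i : ℕ, 1 ≤ i → q ^ i ≠ 1)
    (hp : ∀ i : ℕ, 1 ≤ i → (q ^ 2) ^ i ≠ 1) (a : ℂ) (m : ℕ) :
    PowerSeries.coeff m (qBinomSeries a (q ^ 2) *
      PowerSeries.rescale q (qBinomSeries a (q ^ 2))) = qPoch a q m / qPoch q q m := by
  refine coeff_of_one_sub_X_mul_eq hq (coeff_zero_qBinomSeries_mul_rescale ..) ?_ m
  rw [← mul_assoc, one_sub_X_mul_qBinomSeries hp, map_mul, PowerSeries.rescale_rescale, ← sq]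
  ring

lemma coeff_qBinomSeries_mul_rescale_shift {q : ℂ} (hq : ∀ i : ℕ, 1 ≤ i → q ^ i ≠ 1)
    (hp : ∀ i : ℕ, 1 ≤ i → (q ^ 2) ^ i ≠ 1) (b : ℂ) (m : ℕ) :
    PowerSeries.coeff m (qBinomSeries (b * q ^ 2) (q ^ 2) *
      PowerSeries.rescale q (qBinomSeries b (q ^ 2))) = qPoch (b * q) q m / qPoch q q m := by
  refine coeff_of_one_sub_X_mul_eq hq (coeff_zero_qBinomSeries_mul_rescale ..) ?_ m
  have h := congrArg (PowerSeries.rescale q) (one_sub_C_mul_X_mul_qBinomSeries_mul hp b)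
  have hX : PowerSeries.rescale q (1 - PowerSeries.C b * PowerSeries.X) =
      1 - PowerSeries.C (b * q) * PowerSeries.X := by
    have hC : PowerSeries.rescale q (PowerSeries.C b) = PowerSeries.C b := by
      ext n
      cases n <;> simp [PowerSeries.coeff_rescale, PowerSeries.coeff_C]
    rw [map_sub, map_one, map_mul, hC, PowerSeries.rescale_X, map_mul, mul_assoc]
  rw [map_mul, hX] at h
  rw [← mul_assoc, one_sub_X_mul_qBinomSeries_mul hp, map_mul (PowerSeries.rescale q),
    PowerSeries.rescale_rescale, ← sq, ← h]
  ring

lemma sum_eq_coeff_qBinomSeries {p : ℂ} (hp : ∀ i : ℕ, 1 ≤ i → p ^ i ≠ 1) (q a b : ℂ) (m : ℕ) :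
    ∑ k ∈ Finset.range (m + 1),
      q ^ k * qPoch a p (m - k) * qPoch b p k / qPoch p p m * qBinom p m k =
    PowerSeries.coeff m (qBinomSeries a p * PowerSeries.rescale q (qBinomSeries b p)) := by
  rw [mul_comm, PowerSeries.coeff_mul, Finset.Nat.sum_antidiagonal_eq_sum_range_succ_mk]
  refine Finset.sum_congr rfl fun k hk => ?_
  have hk : k ≤ m := Nat.lt_succ_iff.mp (Finset.mem_range.mp hk)
  rw [PowerSeries.coeff_rescale, coeff_qBinomSeries, coeff_qBinomSeries, qBinom,
    if_pos ⟨by omega, by omega⟩, ← Nat.cast_sub hk, Int.toNat_natCast, Int.toNat_natCast,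
    Int.toNat_natCast]
  have h1 := qPoch_self_ne_zero hp m
  have h2 := qPoch_self_ne_zero hp k
  have h3 := qPoch_self_ne_zero hp (m - k)
  field_simp

lemma qPoch_div_qPoch_eq_qBinom {q : ℂ} (hq0 : q ≠ 0) (hq : ∀ i : ℕ, 1 ≤ i → q ^ i ≠ 1)
    (L m : ℕ) : qPoch (q ^ ((L : ℤ) - m + 1)) q m / qPoch q q m = qBinom q L m := by
  rcases le_or_gt m L with h | h
  · obtain ⟨n, rfl⟩ := Nat.exists_eq_add_of_le' h
    have h1 := qPoch_self_ne_zero hq m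
    have h2 := qPoch_self_ne_zero hq n
    have e : (((n + m : ℕ) : ℤ) - m) = n := by push_cast; ring
    have e' : q ^ ((n : ℤ) + 1) = q ^ (n + 1) := by exact_mod_cast zpow_natCast q (n + 1)
    rw [qBinom, if_pos ⟨by omega, by omega⟩, e, Int.toNat_natCast, Int.toNat_natCast,
      Int.toNat_natCast, ← qPoch_self_mul_qPoch, e']
    field_simp
  · rw [qBinom, if_neg (by omega), div_eq_zero_iff]
    refine Or.inl (Finset.prod_eq_zero (Finset.mem_range.mpr (show m - L - 1 < m by omega)) ?_)
    rw [← zpow_natCast, ← zpow_add₀ hq0,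
      show (L : ℤ) - m + 1 + ((m - L - 1 : ℕ) : ℤ) = 0 by omega, zpow_zero, sub_self]

/-- Corollary of Theorem 4: for all nonnegative integers `L`, `m` and `q ≠ 0` with
`q^i ≠ 1` for `i ≥ 1`,
`Σ_{k=0}^m q^k (q^{2(⌊(L+m)/2⌋−m+1)};q²)_{m−k} (q^{2(⌊(L+m−1)/2⌋−m+1)};q²)_k / (q²;q²)_m
  · [m choose k]_{q²} = [L choose m]_q`. -/
theorem stmt6 (L m : ℕ) (q : ℂ) (hq0 : q ≠ 0) (hq : ∀ i : ℕ, 1 ≤ i → q ^ i ≠ 1) :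
    ∑ k ∈ Finset.range (m + 1),
      q ^ k * qPoch (q ^ (2 * ((((L : ℤ) + m) / 2) - m + 1))) (q ^ 2) (m - k) *
        qPoch (q ^ (2 * ((((L : ℤ) + m - 1) / 2) - m + 1))) (q ^ 2) k /
        qPoch (q ^ 2) (q ^ 2) m * qBinom (q ^ 2) m k
    = qBinom q L m := by
  have hp : ∀ i : ℕ, 1 ≤ i → (q ^ 2) ^ i ≠ 1 := fun i hi => by
    rw [← pow_mul]
    exact hq _ (by omega)
  rw [sum_eq_coeff_qBinomSeries hp, ← qPoch_div_qPoch_eq_qBinom hq0 hq]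
  rcases Int.emod_two_eq_zero_or_one ((L : ℤ) + m) with h | h
  · rw [show 2 * (((L : ℤ) + m) / 2 - m + 1) = (L : ℤ) - m + 2 by omega,
      show 2 * (((L : ℤ) + m - 1) / 2 - m + 1) = (L : ℤ) - m by omega, zpow_add₀ hq0,
      zpow_add_one₀ hq0]
    exact coeff_qBinomSeries_mul_rescale_shift hq hp _ m
  · rw [show 2 * (((L : ℤ) + m) / 2 - m + 1) = (L : ℤ) - m + 1 by omega,
      show 2 * (((L : ℤ) + m - 1) / 2 - m + 1) = (L : ℤ) - m + 1 by omega]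
    exact coeff_qBinomSeries_mul_rescale_self hq hp _ m
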